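/- arXiv:1706.05056 — 3 statements merged into one kernel-verified Lean document; each statement's English description precedes it below -/
import Mathlib

section
/- For every real number r ≥ 2 there exists a constant c_r > 0 such that for all a, b ∈ H one has | ‖a+b‖^r − ‖a‖^r − r‖a‖^{r−2}⟨a,b⟩ | ≤ c_r (‖a‖^{r−2} + ‖b‖^{r−2}) ‖b‖². -/
open scoped RealInnerProductSpace

/-- Tangent line inequality for the convex function `x ^ p`. -/
theorem aux_tangent (p x y : ℝ) (hp : 1 ≤ p) (hx : 0 ≤ x) (hy : 0 ≤ y) :
    x ^ p + p * x ^ (p - 1) * (y - x) ≤ y ^ p := by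
  rcases hx.eq_or_lt with h | h
  · subst h
    rcases hp.eq_or_lt with h1 | h1
    · subst h1; simp
    · rw [Real.zero_rpow (by linarith), Real.zero_rpow (by linarith)]
      simpa using Real.rpow_nonneg hy p
  · have hs : -1 ≤ y / x - 1 := by
      have : 0 ≤ y / x := by positivity
      linarith
    have hb := one_add_mul_self_le_rpow_one_add hs hp
    rw [show 1 + (y / x - 1) = y / x by ring, Real.div_rpow hy hx,
      le_div_iff₀ (Real.rpow_pos_of_pos h p)] at hb
    have hxp : x ^ p = x ^ (p - 1) * x := by
      rw [Real.rpow_sub_one h.ne']; field_simp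
    have e : (1 + p * (y / x - 1)) * x ^ p = x ^ p + p * x ^ (p - 1) * (y - x) := by
      rw [hxp]; field_simp
    linarith

theorem aux_ord (q m M : ℝ) (hq : 0 ≤ q) (hm : 0 ≤ m) (hM : m ≤ M) :
    (M ^ q - m ^ q) * (M ^ 2 - m ^ 2) ≤ 2 * (q + 1) * M ^ q * (M - m) ^ 2 := by
  have hM0 : 0 ≤ M := hm.trans hM
  have h := aux_tangent (q + 1) M m (by linarith) hM0 hm
  rw [add_sub_cancel_right, Real.rpow_add_one' hM0 (by linarith),
    Real.rpow_add_one' hm (by linarith)] at h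
  have h1 : 0 ≤ (M ^ q + m ^ q) * (M - m) :=
    mul_nonneg (add_nonneg (Real.rpow_nonneg hM0 q) (Real.rpow_nonneg hm q)) (by linarith)
  have h2 : (M ^ q - m ^ q) * (M + m) ≤ 2 * (q + 1) * M ^ q * (M - m) := by linarith
  have h3 := mul_le_mul_of_nonneg_right h2 (sub_nonneg.2 hM)
  linarith

theorem aux_scalar (q A B Y : ℝ) (hq : 0 ≤ q) (hA : 0 ≤ A) (hB : 0 ≤ B) (hY : 0 ≤ Y)
    (h1 : Y ≤ A + B) (h2 : A ≤ Y + B) :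
    (Y ^ q - A ^ q) * (Y ^ 2 - A ^ 2) ≤
      2 * (q + 1) * (2 ^ q * (A ^ q + B ^ q)) * B ^ 2 := by
  have hsq : (Y - A) ^ 2 ≤ B ^ 2 := by
    apply sq_le_sq'  <;> linarith
  have hbd : ∀ M : ℝ, 0 ≤ M → M ≤ A + B → M ^ q ≤ 2 ^ q * (A ^ q + B ^ q) := by
    intro M hM0 hM
    have hAq := Real.rpow_nonneg hA q
    have hBq := Real.rpow_nonneg hB q
    have h2q : (0 : ℝ) ≤ 2 ^ q := by positivity
    rcases le_total A B with h | h
    · calc M ^ q ≤ (2 * B) ^ q := Real.rpow_le_rpow hM0 (by linarith) hq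
        _ = 2 ^ q * B ^ q := Real.mul_rpow (by norm_num) hB
        _ ≤ _ := mul_le_mul_of_nonneg_left (by linarith) h2q
    · calc M ^ q ≤ (2 * A) ^ q := Real.rpow_le_rpow hM0 (by linarith) hq
        _ = 2 ^ q * A ^ q := Real.mul_rpow (by norm_num) hA
        _ ≤ _ := mul_le_mul_of_nonneg_left (by linarith) h2q
  rcases le_total A Y with h | h
  · refine (aux_ord q A Y hq hA h).trans ?_
    have := hbd Y hY h1
    gcongr
  · have h3 := aux_ord q Y A hq hY h
    have := hbd A hA (by linarith)
    calc (Y ^ q - A ^ q) * (Y ^ 2 - A ^ 2) = (A ^ q - Y ^ q) * (A ^ 2 - Y ^ 2) := by ring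
      _ ≤ 2 * (q + 1) * A ^ q * (A - Y) ^ 2 := h3
      _ = 2 * (q + 1) * A ^ q * (Y - A) ^ 2 := by ring
      _ ≤ _ := by gcongr

theorem aux_sq (x s : ℝ) (hx : 0 ≤ x) : (x ^ 2) ^ (s / 2) = x ^ s := by
  rw [← Real.rpow_natCast_mul hx]
  congr 1
  push_cast
  ring

/-- For every real `r ≥ 2` there is `c_r > 0` such that for all `a b` in a real inner
product space `H`, `| ‖a+b‖^r − ‖a‖^r − r‖a‖^(r−2)⟨a,b⟩ | ≤ c_r (‖a‖^(r−2) + ‖b‖^(r−2)) ‖b‖²`. -/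
theorem taylor_norm_power_estimate
    {H : Type*} [NormedAddCommGroup H] [InnerProductSpace ℝ H]
    (r : ℝ) (hr : 2 ≤ r) :
    ∃ c : ℝ, 0 < c ∧ ∀ a b : H,
      |‖a + b‖ ^ r - ‖a‖ ^ r - r * ‖a‖ ^ (r - 2) * ⟪a, b⟫| ≤
        c * (‖a‖ ^ (r - 2) + ‖b‖ ^ (r - 2)) * ‖b‖ ^ (2 : ℕ) := by
  have h2q : (0 : ℝ) < 2 ^ (r - 2) := by positivity
  have hq : 0 ≤ r - 2 := by linarith
  refine ⟨r / 2 * (2 * (r - 2 + 1) * 2 ^ (r - 2) + 1), by positivity, fun a b => ?_⟩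
  have hn : ‖a + b‖ ^ 2 = ‖a‖ ^ 2 + 2 * ⟪a, b⟫ + ‖b‖ ^ 2 := norm_add_sq_real a b
  have t1 : ‖a + b‖ ≤ ‖a‖ + ‖b‖ := norm_add_le a b
  have t2 : ‖a‖ ≤ ‖a + b‖ + ‖b‖ := by
    simpa using norm_sub_le (a + b) b
  have hsc := aux_scalar (r - 2) ‖a‖ ‖b‖ ‖a + b‖ hq (norm_nonneg _) (norm_nonneg _)
    (norm_nonneg _) t1 t2
  have c1 := aux_tangent (r / 2) (‖a‖ ^ 2) (‖a + b‖ ^ 2) (by linarith) (by positivity)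
    (by positivity)
  have c2 := aux_tangent (r / 2) (‖a + b‖ ^ 2) (‖a‖ ^ 2) (by linarith) (by positivity)
    (by positivity)
  rw [show r / 2 - 1 = (r - 2) / 2 by ring] at c1 c2
  simp only [aux_sq _ _ (norm_nonneg _)] at c1 c2
  have hA : 0 ≤ ‖a‖ ^ (r - 2) := Real.rpow_nonneg (norm_nonneg _) _
  have hB : 0 ≤ ‖b‖ ^ (r - 2) := Real.rpow_nonneg (norm_nonneg _) _
  generalize ‖a‖ ^ (r - 2) = P at *
  generalize ‖b‖ ^ (r - 2) = Q at *
  generalize ‖a + b‖ ^ (r - 2) = R at *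
  generalize ‖a + b‖ ^ r = U at *
  generalize ‖a‖ ^ r = V at *
  generalize (2 : ℝ) ^ (r - 2) = K at *
  have hi : ⟪a, b⟫ = (‖a + b‖ ^ 2 - ‖a‖ ^ 2 - ‖b‖ ^ 2) / 2 := by linarith
  have hr0 : 0 ≤ r / 2 := by linarith
  have k1 : 0 ≤ r / 2 * (P * ‖b‖ ^ 2) := by positivity
  have k2 : 0 ≤ r / 2 * (Q * ‖b‖ ^ 2) := by positivity
  have k3 := mul_le_mul_of_nonneg_left hsc hr0
  rw [hi, abs_of_nonneg (by linarith)]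
  linarith
end

section
/- For every real number r ≥ 2 there exists a constant K_r > 0 such that for all a, b ∈ H one has ( ‖a+b‖^r − ‖a‖^r )² ≤ K_r ( ‖a‖^{2r−2}‖b‖² + ‖a‖^{2r−4}‖b‖⁴ + ‖b‖^{2r} ). -/
theorem rpow_sub_aux (r : ℝ) (hr : 2 ≤ r) (u v : ℝ) (hv : 0 ≤ v) (hvu : v ≤ u) :
    u ^ r - v ^ r ≤ r * u ^ (r - 1) * (u - v) := by
  rcases (hv.trans hvu).eq_or_lt with h0 | h0
  · have : v = u := le_antisymm hvu (h0 ▸ hv)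
    subst this; simp
  · have hb := one_add_mul_self_le_rpow_one_add (s := v / u - 1) (p := r)
      (by have : 0 ≤ v / u := by positivity
          linarith) (by linarith)
    have e : 1 + (v / u - 1) = v / u := by ring
    rw [e, Real.div_rpow hv h0.le, le_div_iff₀ (by positivity)] at hb
    have e2 : u ^ r = u ^ (r - 1) * u := by
      rw [← Real.rpow_add_one h0.ne']; congr 1; ring
    have e3 : (1 + r * (v / u - 1)) * u ^ r = u ^ r - r * u ^ (r - 1) * (u - v) := by
      rw [e2]; field_simp; ring
    linarith

theorem abs_rpow_sub_aux (r : ℝ) (hr : 2 ≤ r) (x z y M : ℝ) (hx : 0 ≤ x) (hz : 0 ≤ z)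
    (h : |z - x| ≤ y) (hxM : x ≤ M) (hzM : z ≤ M) :
    |z ^ r - x ^ r| ≤ r * M ^ (r - 1) * y := by
  have main : ∀ u v : ℝ, 0 ≤ v → v ≤ u → u ≤ M → u - v ≤ y →
      u ^ r - v ^ r ≤ r * M ^ (r - 1) * y := by
    intro u v hv hvu huM huy
    have hu := hv.trans hvu
    refine (rpow_sub_aux r hr u v hv hvu).trans ?_
    have : u ^ (r - 1) ≤ M ^ (r - 1) := Real.rpow_le_rpow hu huM (by linarith)
    have h1 : 0 ≤ u ^ (r - 1) := Real.rpow_nonneg hu _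
    have h2 : 0 ≤ u - v := by linarith
    have hM := h1.trans this
    gcongr
  obtain ⟨h1, h2⟩ := abs_le.mp h
  rcases le_total x z with hxz | hxz
  · rw [abs_of_nonneg (sub_nonneg.2 (Real.rpow_le_rpow hx hxz (by linarith)))]
    exact main z x hx hxz hzM h2
  · rw [abs_sub_comm, abs_of_nonneg (sub_nonneg.2 (Real.rpow_le_rpow hz hxz (by linarith)))]
    exact main x z hz hxz hxM (by linarith)

/-- For every real `r ≥ 2` there is `K_r > 0` such that for all `a b` in a real inner
product space `H`,
`(‖a+b‖^r − ‖a‖^r)² ≤ K_r (‖a‖^(2r−2)‖b‖² + ‖a‖^(2r−4)‖b‖⁴ + ‖b‖^(2r))`. -/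
theorem sq_diff_norm_power_estimate
    {H : Type*} [NormedAddCommGroup H] [InnerProductSpace ℝ H]
    (r : ℝ) (hr : 2 ≤ r) :
    ∃ K : ℝ, 0 < K ∧ ∀ a b : H,
      (‖a + b‖ ^ r - ‖a‖ ^ r) ^ (2 : ℕ) ≤
        K * (‖a‖ ^ (2 * r - 2) * ‖b‖ ^ (2 : ℕ) + ‖a‖ ^ (2 * r - 4) * ‖b‖ ^ (4 : ℕ)
          + ‖b‖ ^ (2 * r)) := by
  refine ⟨(r * 2 ^ (r - 1)) ^ 2, by positivity, fun a b => ?_⟩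
  have hx := norm_nonneg a
  have hy := norm_nonneg b
  have hz := norm_nonneg (a + b)
  have hd : |‖a + b‖ - ‖a‖| ≤ ‖b‖ := by
    simpa using abs_norm_sub_norm_le (a + b) a
  have ht := norm_add_le a b
  generalize ‖a + b‖ = z at *
  generalize ‖a‖ = x at *
  generalize ‖b‖ = y at *
  have sq : ∀ w : ℝ, 0 ≤ w → (w ^ (r - 1)) ^ 2 = w ^ (2 * r - 2) := by
    intro w hw
    rw [← Real.rpow_mul_natCast hw]; congr 1; push_cast; ring
  rw [← sq_abs]
  have t1 : 0 ≤ x ^ (2 * r - 2) * y ^ 2 := by positivity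
  have t2 : 0 ≤ x ^ (2 * r - 4) * y ^ 4 := by positivity
  have t3 : 0 ≤ y ^ (2 * r) := by positivity
  have key : ∀ M : ℝ, 0 ≤ M → x ≤ M → y ≤ M →
      |z ^ r - x ^ r| ^ 2 ≤ (r * 2 ^ (r - 1)) ^ 2 * (M ^ (2 * r - 2) * y ^ 2) := by
    intro M hM hxM hyM
    have h := abs_rpow_sub_aux r hr x z y (2 * M) hx hz hd (by linarith) (by linarith)
    rw [Real.mul_rpow (by norm_num) hM] at h
    refine (pow_le_pow_left₀ (abs_nonneg _) h 2).trans (le_of_eq ?_)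
    rw [← sq M hM]; ring
  rcases le_total y x with h | h
  · refine (key x hx le_rfl h).trans ?_
    gcongr; linarith
  · refine (key y hy h le_rfl).trans ?_
    have e : y ^ (2 * r - 2) * y ^ 2 = y ^ (2 * r) := by
      rw [← Real.rpow_natCast y 2, ← Real.rpow_add' hy (by push_cast; linarith)]
      congr 1; push_cast; ring
    rw [e]
    gcongr; linarith
end

section
/- There exist constants c > 0 and C ≥ 0 (depending only on N and the coefficients b_0, …, b_N) with the following property: for every measure space (O, μ) and every measurable function d : O → ℝ^n such that ∫_O |d(x)|² dμ(x) < ∞ and ∫_O |d(x)|^{2N+2} dμ(x) < ∞, the function x ↦ f(d(x))·d(x) is integrable and ∫_O f(d(x))·d(x) dμ(x) ≥ c ∫_O |d(x)|^{2N+2} dμ(x) − C ∫_O |d(x)|² dμ(x). -/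
open MeasureTheory
open scoped RealInnerProductSpace

theorem aux_lower_terms (N : ℕ) (hN : 1 ≤ N) (b : ℕ → ℝ) (hb : 0 < b N) :
    ∃ C : ℝ, 0 ≤ C ∧ ∀ r : ℝ, 0 ≤ r →
      |∑ j ∈ Finset.range N, b j * r ^ j| ≤ b N / 2 * r ^ N + C := by
  set S : ℝ := ∑ j ∈ Finset.range N, |b j| with hS
  have hS0 : 0 ≤ S := Finset.sum_nonneg fun j _ => abs_nonneg _
  set R : ℝ := max 1 (2 * S / b N) with hR
  have hR1 : 1 ≤ R := le_max_left _ _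
  have hR2 : 2 * S / b N ≤ R := le_max_right _ _
  refine ⟨S * R ^ N, by positivity, fun r hr => ?_⟩
  have h1 : |∑ j ∈ Finset.range N, b j * r ^ j| ≤ ∑ j ∈ Finset.range N, |b j| * r ^ j := by
    refine (Finset.abs_sum_le_sum_abs _ _).trans (le_of_eq ?_)
    refine Finset.sum_congr rfl fun j _ => ?_
    rw [abs_mul, abs_of_nonneg (pow_nonneg hr j)]
  refine h1.trans ?_
  rcases le_total r R with h | h
  · have h2 : ∑ j ∈ Finset.range N, |b j| * r ^ j ≤ S * R ^ N := by
      rw [hS, Finset.sum_mul]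
      refine Finset.sum_le_sum fun j hj => ?_
      refine mul_le_mul_of_nonneg_left ?_ (abs_nonneg _)
      exact (pow_le_pow_left₀ hr h j).trans
        (pow_le_pow_right₀ hR1 (Finset.mem_range.1 hj).le)
    have : 0 ≤ b N / 2 * r ^ N := by positivity
    linarith
  · have hr1 : 1 ≤ r := hR1.trans h
    have h2 : ∑ j ∈ Finset.range N, |b j| * r ^ j ≤ S * r ^ (N - 1) := by
      rw [hS, Finset.sum_mul]
      refine Finset.sum_le_sum fun j hj => ?_
      refine mul_le_mul_of_nonneg_left ?_ (abs_nonneg _)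
      exact pow_le_pow_right₀ hr1 (Nat.le_sub_one_of_lt (Finset.mem_range.1 hj))
    have h3 : S ≤ b N / 2 * r := by
      have := (div_le_iff₀ hb).1 (hR2.trans h)
      linarith
    have h4 : S * r ^ (N - 1) ≤ b N / 2 * r ^ N := by
      obtain ⟨m, rfl⟩ : ∃ m, N = m + 1 := ⟨N - 1, by omega⟩
      have := mul_le_mul_of_nonneg_right h3 (pow_nonneg hr m)
      rw [Nat.add_sub_cancel, pow_succ]
      linarith
    have : 0 ≤ S * R ^ N := by positivity
    linarith

/-- There exist `c > 0` and `C ≥ 0` such that for every measure space `(O, μ)` and every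
measurable `d : O → ℝ^n` with `∫ |d|² dμ < ∞` and `∫ |d|^(2N+2) dμ < ∞`, the function
`x ↦ f(d(x))·d(x)` is integrable and
`∫ f(d(x))·d(x) dμ ≥ c ∫ |d(x)|^(2N+2) dμ − C ∫ |d(x)|² dμ`. -/
theorem integral_inner_f_self_coercive
    (n : ℕ) (hn : 1 ≤ n) (N : ℕ) (hN : 1 ≤ N) (b : ℕ → ℝ) (hb : 0 < b N) :
    ∃ c : ℝ, 0 < c ∧ ∃ C : ℝ, 0 ≤ C ∧
      ∀ (O : Type*) [MeasurableSpace O] (μ : Measure O)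
        (d : O → EuclideanSpace ℝ (Fin n)), Measurable d →
        Integrable (fun x => ‖d x‖ ^ 2) μ →
        Integrable (fun x => ‖d x‖ ^ (2 * N + 2)) μ →
        Integrable (fun x =>
          ⟪(∑ j ∈ Finset.range (N + 1), b j * (‖d x‖ ^ 2) ^ j) • d x, d x⟫) μ ∧
        c * (∫ x, ‖d x‖ ^ (2 * N + 2) ∂μ) - C * (∫ x, ‖d x‖ ^ 2 ∂μ) ≤
          ∫ x, ⟪(∑ j ∈ Finset.range (N + 1), b j * (‖d x‖ ^ 2) ^ j) • d x, d x⟫ ∂μ := by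
  obtain ⟨C, hC, hbd⟩ := aux_lower_terms N hN b hb
  refine ⟨b N / 2, by positivity, C, hC, ?_⟩
  intro O _ μ d hd h2 hN2
  have key : ∀ x, |⟪(∑ j ∈ Finset.range (N + 1), b j * (‖d x‖ ^ 2) ^ j) • d x, d x⟫
      - b N * ‖d x‖ ^ (2 * N + 2)| ≤ b N / 2 * ‖d x‖ ^ (2 * N + 2) + C * ‖d x‖ ^ 2 := by
    intro x
    have hr : 0 ≤ ‖d x‖ ^ 2 := by positivity
    have h := mul_le_mul_of_nonneg_right (hbd _ hr) hr
    have e : ‖d x‖ ^ (2 * N + 2) = (‖d x‖ ^ 2) ^ N * ‖d x‖ ^ 2 := by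
      rw [pow_add, pow_mul]
    rw [real_inner_smul_left, real_inner_self_eq_norm_sq, Finset.sum_range_succ, e]
    rw [← abs_of_nonneg hr, ← abs_mul, abs_of_nonneg hr] at h
    refine le_trans (le_of_eq ?_) (h.trans (le_of_eq ?_))
    · congr 1
      ring
    · ring
  have hmeas : Measurable (fun x =>
      ⟪(∑ j ∈ Finset.range (N + 1), b j * (‖d x‖ ^ 2) ^ j) • d x, d x⟫) := by
    fun_prop
  have hint : Integrable (fun x =>
      ⟪(∑ j ∈ Finset.range (N + 1), b j * (‖d x‖ ^ 2) ^ j) • d x, d x⟫) μ := by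
    refine Integrable.mono' ((hN2.const_mul (b N + b N / 2)).add (h2.const_mul C))
      hmeas.aestronglyMeasurable (Filter.Eventually.of_forall fun x => ?_)
    have h := abs_le.1 (key x)
    have h0 : 0 ≤ b N * ‖d x‖ ^ (2 * N + 2) := by positivity
    simp only [Pi.add_apply]
    rw [Real.norm_eq_abs, abs_le]
    constructor <;> linarith [h.1, h.2]
  refine ⟨hint, ?_⟩
  rw [← integral_const_mul, ← integral_const_mul,
    ← integral_sub (hN2.const_mul _) (h2.const_mul _)]
  refine integral_mono ((hN2.const_mul _).sub (h2.const_mul _)) hint fun x => ?_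
  have h := (abs_le.1 (key x)).1
  simp only [Pi.sub_apply]
  linarith
end
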